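/- arXiv:1901.00981 — 3 statements merged into one kernel-verified Lean document; each statement's English description precedes it below -/
import Mathlib

section
/- Let U be continuous on the closed unit disk, real-valued, harmonic on the open unit disk, and have vanishing integral over the unit circle (so that in particular U(0) = 0). Define V(z) = ∫₀¹ U(ρz)/ρ dρ for z in the closed unit disk. Then: (i) V is well defined (the integrand is integrable on (0,1)); (ii) V is harmonic on the open unit disk; (iii) V(0) = 0; and (iv) for every θ ∈ ℝ and every r ∈ (0,1), the radial derivative satisfies d/dr V(re^{iθ}) = U(re^{iθ})/r, so that by continuity of U the radial derivative of V tends to U(e^{iθ}) as r → 1⁻; i.e. V solves the Neumann problem on the unit disk with boundary data equal to the boundary values of U. -/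
open MeasureTheory intervalIntegral Metric Set Filter

/-- A real-valued function on `ℂ ≅ ℝ²` is harmonic on a set if it is twice continuously
differentiable there and its Laplacian `∂²f/∂x² + ∂²f/∂y²` vanishes identically. -/
def HarmonicOnSet (f : ℂ → ℝ) (s : Set ℂ) : Prop :=
  ContDiffOn ℝ 2 f s ∧ ∀ z ∈ s,
    fderiv ℝ (fun w => fderiv ℝ f w 1) z 1
      + fderiv ℝ (fun w => fderiv ℝ f w Complex.I) z Complex.I = 0

open InnerProductSpace Complex in
theorem laplacian_eq_fderiv_fderiv_complexPlane {f : ℂ → ℝ} {z : ℂ} (hf : ContDiffAt ℝ 2 f z) :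
    Laplacian.laplacian f z =
      fderiv ℝ (fun w => fderiv ℝ f w 1) z 1 + fderiv ℝ (fun w => fderiv ℝ f w I) z I := by
  have hd : DifferentiableAt ℝ (fderiv ℝ f) z :=
    (hf.fderiv_right (m := 1) (by norm_num)).differentiableAt one_ne_zero
  have key (v : ℂ) : fderiv ℝ (fun w => fderiv ℝ f w v) z v = fderiv ℝ (fderiv ℝ f) z v v := by
    rw [fderiv_clm_apply hd (differentiableAt_const v)]
    simp
  simp [laplacian_eq_iteratedFDeriv_complexPlane, iteratedFDeriv_two_apply, key]

open InnerProductSpace in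
theorem harmonicOnSet_iff_harmonicOnNhd {f : ℂ → ℝ} {s : Set ℂ} (hs : IsOpen s) :
    HarmonicOnSet f s ↔ HarmonicOnNhd f s := by
  constructor
  · rintro ⟨hc, hl⟩ z hz
    have hc' : ∀ w ∈ s, ContDiffAt ℝ 2 f w := fun w hw => hc.contDiffAt (hs.mem_nhds hw)
    refine ⟨hc' z hz, ?_⟩
    filter_upwards [hs.mem_nhds hz] with w hw
    rw [laplacian_eq_fderiv_fderiv_complexPlane (hc' w hw), hl w hw, Pi.zero_apply]
  · intro h
    refine ⟨h.contDiffOn, fun z hz => ?_⟩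
    rw [← laplacian_eq_fderiv_fderiv_complexPlane (h z hz).1]
    exact (h z hz).2.eq_of_nhds

/-- A continuous function on the closed unit disk that is harmonic inside and has vanishing
integral over the unit circle is `z ↦ Re (z G(z))` on the open disk, where `G` is the derivative of a function `H`
holomorphic there with `H 0 = 0`. -/
theorem HarmonicOnSet.exists_re_mul_deriv_eq {U : ℂ → ℝ}
    (hUc : ContinuousOn U (closedBall (0 : ℂ) 1)) (hUh : HarmonicOnSet U (ball (0 : ℂ) 1))
    (hUmean : (∫ θ in (0:ℝ)..(2 * Real.pi), U (Complex.exp (θ * Complex.I))) = 0) :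
    ∃ H G : ℂ → ℂ, H 0 = 0 ∧ (∀ z ∈ ball (0 : ℂ) 1, HasDerivAt H (G z) z) ∧
      ContinuousOn G (ball (0 : ℂ) 1) ∧ ∀ z ∈ ball (0 : ℂ) 1, U z = (z * G z).re := by
  have hN := (harmonicOnSet_iff_harmonicOnNhd isOpen_ball).1 hUh
  have hU0 : U 0 = 0 := by
    have hcl : InnerProductSpace.HarmonicContOnCl U (ball (0 : ℂ) |1|) := by
      rw [abs_one]
      exact ⟨hN, by rwa [closure_ball _ one_ne_zero]⟩
    rw [← hcl.circleAverage_eq, Real.circleAverage_def]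
    simp [circleMap, hUmean]
  obtain ⟨F, hF, hFU⟩ := hN.exists_analyticOnNhd_ball_re_eq
  have h0 : (0 : ℂ) ∈ ball (0 : ℂ) 1 := mem_ball_self one_pos
  have hG : DifferentiableOn ℂ (dslope F 0) (ball 0 1) :=
    (Complex.differentiableOn_dslope (ball_mem_nhds 0 one_pos)).2 hF.differentiableOn
  obtain ⟨H, hH0, hH⟩ := hG.isExactOn_ball.with_val_at 0 0
  refine ⟨H, dslope F 0, hH0, hH, hG.continuousOn, fun z hz => ?_⟩
  have h := sub_smul_dslope F 0 z
  rw [sub_zero, smul_eq_mul] at h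
  have hF0 : (F 0).re = 0 := (hFU h0).trans hU0
  rw [h, Complex.sub_re, hF0, sub_zero]
  exact (hFU hz).symm

theorem ofReal_mul_mem_ball {ρ : ℝ} {z : ℂ} (hρ : |ρ| < 1) (hz : z ∈ closedBall (0 : ℂ) 1) :
    (ρ : ℂ) * z ∈ ball (0 : ℂ) 1 := by
  rw [mem_closedBall_zero_iff] at hz
  rw [mem_ball_zero_iff, norm_mul, Complex.norm_real, Real.norm_eq_abs]
  nlinarith [abs_nonneg ρ, norm_nonneg z]

theorem hasDerivAt_re_comp_ofReal_mul {H G : ℂ → ℂ} {ρ : ℝ} {z : ℂ}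
    (hH : HasDerivAt H (G (ρ * z)) (ρ * z)) :
    HasDerivAt (fun t : ℝ => (H (t * z)).re) ((z * G (ρ * z)).re) ρ := by
  have h : HasDerivAt (fun t : ℂ => H (t * z)) (z * G (ρ * z)) (ρ : ℂ) := by
    have := HasDerivAt.comp (ρ : ℂ) hH (hasDerivAt_mul_const z)
    rwa [mul_comm] at this
  exact h.real_of_complex

/-- If `U` is continuous on the closed unit disk, harmonic on the open unit
disk, and has vanishing integral over the unit circle, then
`V z = ∫₀¹ U(ρ z)/ρ dρ` is well defined (the integrand is interval integrable), harmonic on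
the open unit disk, satisfies `V 0 = 0`, and its radial derivative at `r e^{iθ}`
(for `0 < r < 1`) equals `U(r e^{iθ})/r`, which tends to `U(e^{iθ})` as `r → 1⁻`;
i.e. `V` solves the Neumann problem on the unit disk with data the boundary values of `U`. -/
theorem dirichlet_to_neumann_unit_disk (U : ℂ → ℝ)
    (hUc : ContinuousOn U (closedBall (0 : ℂ) 1))
    (hUh : HarmonicOnSet U (ball (0 : ℂ) 1))
    (hUmean : (∫ θ in (0:ℝ)..(2 * Real.pi), U (Complex.exp (θ * Complex.I))) = 0)
    (V : ℂ → ℝ)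
    (hV : ∀ z : ℂ, V z = ∫ ρ in (0:ℝ)..1, U ((ρ : ℂ) * z) / ρ) :
    (∀ z ∈ closedBall (0 : ℂ) 1,
        IntervalIntegrable (fun ρ : ℝ => U ((ρ : ℂ) * z) / ρ) volume 0 1) ∧
    HarmonicOnSet V (ball (0 : ℂ) 1) ∧
    V 0 = 0 ∧
    (∀ θ : ℝ, ∀ r ∈ Set.Ioo (0:ℝ) 1,
        HasDerivAt (fun ρ : ℝ => V ((ρ : ℂ) * Complex.exp (θ * Complex.I)))
          (U ((r : ℂ) * Complex.exp (θ * Complex.I)) / r) r) ∧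
    (∀ θ : ℝ,
        Tendsto (fun r : ℝ => U ((r : ℂ) * Complex.exp (θ * Complex.I)) / r)
          (nhdsWithin 1 (Set.Iio 1)) (nhds (U (Complex.exp (θ * Complex.I))))) := by
  obtain ⟨H, G, hH0, hH, hG, hUG⟩ := hUh.exists_re_mul_deriv_eq hUc hUmean
  have hquot {ρ : ℝ} {z : ℂ} (hρ : ρ ≠ 0) (h : (ρ : ℂ) * z ∈ ball (0 : ℂ) 1) :
      U (ρ * z) / ρ = (z * G (ρ * z)).re := by
    rw [hUG _ h, mul_assoc, Complex.re_ofReal_mul, mul_div_cancel_left₀ _ hρ]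
  have hcont {z : ℂ} {b : ℝ} (hb : 0 ≤ b) (h : ∀ ρ ∈ Icc 0 b, (ρ : ℂ) * z ∈ ball (0 : ℂ) 1) :
      IntervalIntegrable (fun ρ : ℝ => (z * G (ρ * z)).re) volume 0 b := by
    refine ContinuousOn.intervalIntegrable ?_
    rw [uIcc_of_le hb]
    refine Complex.continuous_re.comp_continuousOn (continuousOn_const.mul ?_)
    exact hG.comp (by fun_prop) h
  have hVH : ∀ z ∈ ball (0 : ℂ) 1, V z = (H z).re := by
    intro z hz
    have hmem : ∀ ρ ∈ Icc (0 : ℝ) 1, (ρ : ℂ) * z ∈ ball (0 : ℂ) 1 := by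
      intro ρ hρ
      rw [mem_ball_zero_iff] at hz ⊢
      rw [norm_mul, Complex.norm_real, Real.norm_eq_abs, abs_of_nonneg hρ.1]
      nlinarith [norm_nonneg z, hρ.1, hρ.2]
    rw [hV, integral_congr_uIoo (g := fun ρ : ℝ => (z * G (ρ * z)).re),
      integral_eq_sub_of_hasDerivAt (f := fun t : ℝ => (H (t * z)).re) ?_
        (hcont zero_le_one hmem)]
    · simp [hH0]
    · intro ρ hρ
      rw [uIcc_of_le zero_le_one] at hρ
      exact hasDerivAt_re_comp_ofReal_mul (hH _ (hmem ρ hρ))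
    · intro ρ hρ
      rw [uIoo_of_le zero_le_one] at hρ
      exact hquot hρ.1.ne' (hmem ρ (Ioo_subset_Icc_self hρ))
  have hexp (θ : ℝ) : Complex.exp (θ * Complex.I) ∈ closedBall (0 : ℂ) 1 := by
    rw [mem_closedBall_zero_iff, Complex.norm_exp_ofReal_mul_I]
  refine ⟨fun z hz => ?_, ?_, ?_, fun θ r hr => ?_, fun θ => ?_⟩
  · refine IntervalIntegrable.trans (b := 1 / 2) ?_ (ContinuousOn.intervalIntegrable ?_)
    · refine (hcont (z := z) (by norm_num) fun ρ hρ => ?_).congr_uIoo fun ρ hρ => ?_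
      · exact ofReal_mul_mem_ball (by rw [abs_of_nonneg hρ.1]; linarith [hρ.2]) hz
      · rw [uIoo_of_le (by norm_num)] at hρ
        exact (hquot hρ.1.ne' <|
          ofReal_mul_mem_ball (by rw [abs_of_pos hρ.1]; linarith [hρ.2]) hz).symm
    · rw [uIcc_of_le (by norm_num)]
      refine (hUc.comp (by fun_prop) fun ρ hρ => ?_).div (by fun_prop) fun ρ hρ => ?_
      · rw [mem_closedBall_zero_iff] at hz ⊢
        rw [norm_mul, Complex.norm_real, Real.norm_eq_abs, abs_of_nonneg (by linarith [hρ.1])]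
        nlinarith [norm_nonneg z, hρ.1, hρ.2]
      · linarith [hρ.1]
  · rw [harmonicOnSet_iff_harmonicOnNhd isOpen_ball]
    intro z hz
    have hHd : DifferentiableOn ℂ H (ball 0 1) :=
      fun w hw => (hH w hw).differentiableAt.differentiableWithinAt
    refine (InnerProductSpace.harmonicAt_congr_nhds ?_).2
      (hHd.analyticAt (isOpen_ball.mem_nhds hz)).harmonicAt_re
    filter_upwards [isOpen_ball.mem_nhds hz] with w hw using hVH w hw
  · rw [hVH 0 (mem_ball_self one_pos), hH0, Complex.zero_re]
  · have hball : ∀ ρ ∈ Ioo (0 : ℝ) 1, (ρ : ℂ) * Complex.exp (θ * Complex.I) ∈ ball (0 : ℂ) 1 :=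
      fun ρ hρ => ofReal_mul_mem_ball (by rw [abs_of_pos hρ.1]; exact hρ.2) (hexp θ)
    rw [hquot hr.1.ne' (hball r hr)]
    refine (hasDerivAt_re_comp_ofReal_mul (hH _ (hball r hr))).congr_of_eventuallyEq ?_
    filter_upwards [isOpen_Ioo.mem_nhds hr] with ρ hρ using hVH _ (hball ρ hρ)
  · have hmaps : Tendsto (fun r : ℝ => (r : ℂ) * Complex.exp (θ * Complex.I))
        (nhdsWithin 1 (Iio 1)) (nhdsWithin (Complex.exp (θ * Complex.I)) (closedBall 0 1)) := by
      refine tendsto_nhdsWithin_iff.2 ⟨?_, ?_⟩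
      · have : ContinuousAt (fun r : ℝ => (r : ℂ) * Complex.exp (θ * Complex.I)) 1 := by fun_prop
        simpa [ContinuousAt] using this.mono_left nhdsWithin_le_nhds
      · filter_upwards [Ioo_mem_nhdsLT (zero_lt_one' ℝ)] with r hr
        exact ball_subset_closedBall
          (ofReal_mul_mem_ball (by rw [abs_of_pos hr.1]; exact hr.2) (hexp θ))
    have hid : Tendsto (fun r : ℝ => r) (nhdsWithin 1 (Iio 1)) (nhds 1) :=
      tendsto_id.mono_left nhdsWithin_le_nhds
    simpa [Function.comp_def, Pi.div_def] using
      ((hUc _ (hexp θ)).tendsto.comp hmaps).div hid one_ne_zero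
end

section
/- Let Ω ⊆ ℂ ∖ {0} be open and simply connected, let L be a holomorphic branch of the logarithm on Ω (i.e. exp(L(ζ)) = ζ for all ζ ∈ Ω), and for c ∈ ℂ write ζ^c := exp(c·L(ζ)). Let a, b ∈ ℂ with b ≠ 0, and let f, g, h be holomorphic on Ω satisfying a·h(ζ) + b·ζ·h′(ζ) = ζ·f′(ζ) + g(ζ) for all ζ ∈ Ω. Then for any two points z, z₀ ∈ Ω such that the straight segment from z to z₀ is contained in Ω, one has h(z) = (z₀/z)^{a/b} · (h(z₀) − f(z₀)/b) + f(z)/b − (1/b)·z^{−a/b} · ∫_{[z,z₀]} ζ^{a/b − 1} · (g(ζ) − (a/b)·f(ζ)) dζ, where (z₀/z)^{a/b} := exp((a/b)(L(z₀) − L(z))) and the integral is the complex path integral along the segment from z to z₀. -/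
open intervalIntegral

/-- The complex path integral of `F` along the straight segment from `a` to `b`. -/
noncomputable def segIntegral (F : ℂ → ℂ) (a b : ℂ) : ℂ :=
  ∫ t in (0:ℝ)..1, (b - a) * F (a + (t : ℂ) * (b - a))

/-- A holomorphic branch of the logarithm has derivative `1 / ζ`. -/
theorem hasDerivAt_of_exp_eq {Ω : Set ℂ} (hΩ : IsOpen Ω) {L : ℂ → ℂ}
    (hL : DifferentiableOn ℂ L Ω) (hexp : ∀ ζ ∈ Ω, Complex.exp (L ζ) = ζ) {ζ : ℂ} (hζ : ζ ∈ Ω) :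
    HasDerivAt L ζ⁻¹ ζ := by
  have hd : HasDerivAt L (deriv L ζ) ζ := (hL.differentiableAt (hΩ.mem_nhds hζ)).hasDerivAt
  have hid : HasDerivAt (fun w => Complex.exp (L w)) 1 ζ :=
    (hasDerivAt_id ζ).congr_of_eventuallyEq (Filter.eventuallyEq_of_mem (hΩ.mem_nhds hζ) hexp)
  have h1 : ζ * deriv L ζ = 1 := by
    simpa only [hexp ζ hζ] using hd.cexp.unique hid
  rwa [← eq_inv_of_mul_eq_one_right h1]

/-- The fundamental theorem of calculus along a straight segment. -/
theorem segIntegral_eq_sub {G F : ℂ → ℂ} {z w : ℂ}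
    (hG : ∀ ζ ∈ segment ℝ z w, HasDerivAt G (F ζ) ζ) (hF : ContinuousOn F (segment ℝ z w)) :
    segIntegral F z w = G w - G z := by
  have hmem : ∀ t ∈ Set.uIcc (0 : ℝ) 1, z + (t : ℂ) * (w - z) ∈ segment ℝ z w := by
    intro t ht
    rw [Set.uIcc_of_le zero_le_one] at ht
    rw [segment_eq_image']
    exact ⟨t, ht, by simp⟩
  have hderiv : ∀ t ∈ Set.uIcc (0 : ℝ) 1,
      HasDerivAt (fun t : ℝ => G (z + (t : ℂ) * (w - z)))
        ((w - z) * F (z + (t : ℂ) * (w - z))) t := by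
    intro t ht
    have hline : HasDerivAt (fun t : ℝ => z + (t : ℂ) * (w - z)) (w - z) t := by
      simpa using ((Complex.ofRealCLM.hasDerivAt (x := t)).mul_const (w - z)).const_add z
    simpa only [Function.comp_def, smul_eq_mul] using (hG _ (hmem t ht)).scomp t hline
  have hcont : ContinuousOn (fun t : ℝ => (w - z) * F (z + (t : ℂ) * (w - z)))
      (Set.uIcc (0 : ℝ) 1) :=
    continuousOn_const.mul (hF.comp (by fun_prop) hmem)
  rw [segIntegral, intervalIntegral.integral_eq_sub_of_hasDerivAt hderiv
    hcont.intervalIntegrable]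
  simp

/-- Let `Ω ⊆ ℂ ∖ {0}` be open and simply connected, `L` a holomorphic
branch of the logarithm on `Ω`, and write `ζ^c := exp(c·L(ζ))`. Let `a, b ∈ ℂ`, `b ≠ 0`, and
`f, g, h` holomorphic on `Ω` with `a·h(ζ) + b·ζ·h′(ζ) = ζ·f′(ζ) + g(ζ)` on `Ω`. Then for
`z, z₀ ∈ Ω` with the segment `[z, z₀] ⊆ Ω`:
`h(z) = (z₀/z)^{a/b}(h(z₀) − f(z₀)/b) + f(z)/b
        − (1/b) z^{−a/b} ∫_{[z,z₀]} ζ^{a/b−1}(g(ζ) − (a/b) f(ζ)) dζ`. -/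
theorem robin_from_dirichlet_and_neumann (Ω : Set ℂ) (hΩopen : IsOpen Ω)
    (hΩ : Ω ⊆ {(0 : ℂ)}ᶜ) (hΩsc : SimplyConnectedSpace ↥Ω)
    (L : ℂ → ℂ) (hLhol : DifferentiableOn ℂ L Ω)
    (hLlog : ∀ ζ ∈ Ω, Complex.exp (L ζ) = ζ)
    (a b : ℂ) (hb : b ≠ 0) (f g h f' h' : ℂ → ℂ)
    (hf : ∀ ζ ∈ Ω, HasDerivAt f (f' ζ) ζ)
    (hh : ∀ ζ ∈ Ω, HasDerivAt h (h' ζ) ζ)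
    (hg : DifferentiableOn ℂ g Ω)
    (hrel : ∀ ζ ∈ Ω, a * h ζ + b * ζ * h' ζ = ζ * f' ζ + g ζ)
    (z z₀ : ℂ) (hz : z ∈ Ω) (hz₀ : z₀ ∈ Ω) (hseg : segment ℝ z z₀ ⊆ Ω) :
    h z = Complex.exp ((a / b) * (L z₀ - L z)) * (h z₀ - f z₀ / b) + f z / b
      - (1 / b) * Complex.exp (-(a / b) * L z)
          * segIntegral
              (fun ζ => Complex.exp ((a / b - 1) * L ζ) * (g ζ - (a / b) * f ζ)) z z₀ := by
  have hderiv : ∀ ζ ∈ Ω, HasDerivAt (fun w => Complex.exp ((a / b) * L w) * (b * h w - f w))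
      (Complex.exp ((a / b - 1) * L ζ) * (g ζ - (a / b) * f ζ)) ζ := by
    intro ζ hζ
    have hζ0 : ζ ≠ 0 := hΩ hζ
    have hL := hasDerivAt_of_exp_eq hΩopen hLhol hLlog hζ
    have hpow : Complex.exp ((a / b) * L ζ) = Complex.exp ((a / b - 1) * L ζ) * ζ := by
      calc Complex.exp ((a / b) * L ζ) = Complex.exp ((a / b - 1) * L ζ + L ζ) := by ring_nf
        _ = Complex.exp ((a / b - 1) * L ζ) * ζ := by rw [Complex.exp_add, hLlog ζ hζ]
    refine ((hL.const_mul (a / b)).cexp.mul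
      (((hh ζ hζ).const_mul b).sub (hf ζ hζ))).congr_deriv ?_
    rw [hpow]
    have hr : g ζ = a * h ζ + b * ζ * h' ζ - ζ * f' ζ := by linear_combination -hrel ζ hζ
    rw [hr]
    simp only [Pi.sub_apply]
    field_simp
    ring
  have hcont : ContinuousOn
      (fun ζ => Complex.exp ((a / b - 1) * L ζ) * (g ζ - (a / b) * f ζ)) (segment ℝ z z₀) := by
    have hLc := hLhol.continuousOn.mono hseg
    have hgc := hg.continuousOn.mono hseg
    have hfc : ContinuousOn f (segment ℝ z z₀) := fun ζ hζ =>
      (hf ζ (hseg hζ)).continuousAt.continuousWithinAt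
    fun_prop
  rw [segIntegral_eq_sub (fun ζ hζ => hderiv ζ (hseg hζ)) hcont,
    show (a / b) * (L z₀ - L z) = -(a / b) * L z + (a / b) * L z₀ by ring, Complex.exp_add]
  have hinv : Complex.exp (-(a / b) * L z) * Complex.exp ((a / b) * L z) = 1 := by
    rw [← Complex.exp_add, neg_mul, neg_add_cancel, Complex.exp_zero]
  have hbinv : b * (1 / b) = 1 := by field_simp
  linear_combination (f z / b - h z) * hinv +
    (Complex.exp (-(a / b) * L z) * Complex.exp ((a / b) * L z₀) * h z₀ -
      Complex.exp (-(a / b) * L z) * Complex.exp ((a / b) * L z) * h z) * hbinv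
end

section
/- Let Ω₁, Ω₂ ⊆ ℂ be open, let S : Ω₁ → ℂ be holomorphic with S(Ω₁) ⊆ Ω₂, and let S̃ : Ω₂ → ℂ be holomorphic with S̃(Ω₂) ⊆ Ω₁, S̃(S(z)) = z for all z ∈ Ω₁ and S(S̃(ζ)) = ζ for all ζ ∈ Ω₂. Let s be holomorphic on Ω₁ with s(z)² = S′(z), let t be holomorphic on Ω₂ with t(ξ)² = S̃′(ξ), and assume t(S(z))·s(z) = 1 for all z ∈ Ω₁. Let u₁, v₁ be holomorphic on Ω₁ and u₂, v₂ holomorphic on Ω₂ with v₁′(z) = −i·u₁(z)·s(z) on Ω₁ and v₂′(ξ) = i·u₂(ξ)·t(ξ) on Ω₂. Then for all z ∈ Ω₁ and ζ ∈ Ω₂ such that the straight segment from S̃(ζ) to z is contained in Ω₁, the following reflection identity holds: v₁(S̃(ζ)) + v₂(S(z)) = v₁(z) + v₂(ζ) + i·∫_{[S̃(ζ), z]} ( u₁(τ) + u₂(S(τ)) )·s(τ) dτ, where the integral is the complex path integral along the segment from S̃(ζ) to z. (This is the reflection formula, about an arc of an algebraic curve Γ with Schwarz function S, for a harmonic function v(z,ζ)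 = v₁(z) + v₂(ζ) subject to a nonhomogeneous Neumann condition on Γ with data φ whose holomorphic extension to the complexification {ζ = S(z)} of Γ is φ(τ, S(τ)) = u₁(τ) + u₂(S(τ)); the pair (S̃(ζ), S(z)) is the reflection of the point (z, ζ) in Γ.) -/
open intervalIntegral

/-- The fundamental theorem of calculus along a straight segment. -/
theorem segIntegral_eq_sub_of_hasDerivAt {F W : ℂ → ℂ} {a b : ℂ}
    (hF : ContinuousOn F (segment ℝ a b)) (hW : ∀ τ ∈ segment ℝ a b, HasDerivAt W (F τ) τ) :
    segIntegral F a b = W b - W a := by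
  have hmem : ∀ x ∈ Set.uIcc (0 : ℝ) 1, a + (x : ℂ) * (b - a) ∈ segment ℝ a b := by
    intro x hx
    rw [Set.uIcc_of_le zero_le_one] at hx
    rw [segment_eq_image']
    exact ⟨x, hx, by simp⟩
  have hderiv : ∀ x ∈ Set.uIcc (0 : ℝ) 1,
      HasDerivAt (fun x : ℝ => W (a + (x : ℂ) * (b - a)))
        ((b - a) * F (a + (x : ℂ) * (b - a))) x := by
    intro x hx
    have hline : HasDerivAt (fun x : ℝ => a + (x : ℂ) * (b - a)) (b - a) x := by
      simpa using ((Complex.ofRealCLM.hasDerivAt (x := x)).mul_const (b - a)).const_add a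
    rw [mul_comm]
    exact (hW _ (hmem x hx)).comp x hline
  have hcont : ContinuousOn (fun x : ℝ => (b - a) * F (a + (x : ℂ) * (b - a)))
      (Set.uIcc (0 : ℝ) 1) :=
    continuousOn_const.mul (hF.comp (by fun_prop) hmem)
  rw [segIntegral, integral_eq_sub_of_hasDerivAt hderiv hcont.intervalIntegrable]
  simp

/-- Reflection formula about an arc of an algebraic curve `Γ` with Schwarz
function `S` (derivative `S'`, holomorphic two-sided inverse `Sinv` with derivative `Sinv'`),
for a harmonic function `v(z,ζ) = v₁(z) + v₂(ζ)` subject to a nonhomogeneous Neumann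
condition on `Γ` with data whose holomorphic extension to `{ζ = S(z)}` is
`φ(τ, S(τ)) = u₁(τ) + u₂(S(τ))`; here `s, t` are holomorphic square roots of `S'`, `Sinv'`
with `t(S z)·s z = 1`, and `v₁′ = −i·u₁·s`, `v₂′ = i·u₂·t` encode the Dirichlet-to-Neumann
formula. Then
`v₁(Sinv ζ) + v₂(S z) = v₁(z) + v₂(ζ) + i∫_{[Sinv ζ, z]} (u₁(τ) + u₂(S τ))·s(τ) dτ`. -/
theorem reflection_neumann_algebraic_curve (Ω₁ Ω₂ : Set ℂ)
    (hΩ₁ : IsOpen Ω₁) (hΩ₂ : IsOpen Ω₂)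
    (S Sinv S' Sinv' s t u₁ u₂ v₁ v₂ : ℂ → ℂ)
    (hS : ∀ z ∈ Ω₁, HasDerivAt S (S' z) z)
    (hmaps : Set.MapsTo S Ω₁ Ω₂)
    (hSinv : ∀ ξ ∈ Ω₂, HasDerivAt Sinv (Sinv' ξ) ξ)
    (hmaps' : Set.MapsTo Sinv Ω₂ Ω₁)
    (hinv : ∀ z ∈ Ω₁, Sinv (S z) = z)
    (hinv' : ∀ ζ ∈ Ω₂, S (Sinv ζ) = ζ)
    (hs : DifferentiableOn ℂ s Ω₁) (hs2 : ∀ z ∈ Ω₁, s z ^ 2 = S' z)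
    (ht : DifferentiableOn ℂ t Ω₂) (ht2 : ∀ ξ ∈ Ω₂, t ξ ^ 2 = Sinv' ξ)
    (hts : ∀ z ∈ Ω₁, t (S z) * s z = 1)
    (hu₁ : DifferentiableOn ℂ u₁ Ω₁) (hu₂ : DifferentiableOn ℂ u₂ Ω₂)
    (hv₁ : ∀ z ∈ Ω₁, HasDerivAt v₁ (-Complex.I * u₁ z * s z) z)
    (hv₂ : ∀ ξ ∈ Ω₂, HasDerivAt v₂ (Complex.I * u₂ ξ * t ξ) ξ) :
    ∀ z ∈ Ω₁, ∀ ζ ∈ Ω₂, segment ℝ (Sinv ζ) z ⊆ Ω₁ →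
      v₁ (Sinv ζ) + v₂ (S z)
        = v₁ z + v₂ ζ
          + Complex.I * segIntegral (fun τ => (u₁ τ + u₂ (S τ)) * s τ) (Sinv ζ) z := by
  intro z hz ζ hζ hseg
  set F : ℂ → ℂ := fun τ => (u₁ τ + u₂ (S τ)) * s τ with hFdef
  have hScont : ContinuousOn S Ω₁ := HasDerivAt.continuousOn hS
  have hF : ContinuousOn F Ω₁ :=
    (hu₁.continuousOn.add (hu₂.continuousOn.comp hScont hmaps)).mul hs.continuousOn
  have hW : ∀ τ ∈ Ω₁,
      HasDerivAt (fun τ => -Complex.I * (v₂ (S τ) - v₁ τ)) (F τ) τ := by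
    intro τ hτ
    have h := (((hv₂ _ (hmaps hτ)).comp τ (hS τ hτ)).sub (hv₁ τ hτ)).const_mul (-Complex.I)
    refine h.congr_deriv ?_
    rw [← hs2 τ hτ]
    linear_combination (norm := (simp only [hFdef]; ring_nf))
      (-Complex.I ^ 2 * u₂ (S τ) * s τ) * hts τ hτ
        - (u₁ τ + u₂ (S τ)) * s τ * Complex.I_sq
  rw [segIntegral_eq_sub_of_hasDerivAt (hF.mono hseg) fun τ hτ => hW τ (hseg hτ), hinv' ζ hζ]
  linear_combination (v₂ (S z) - v₁ z - v₂ ζ + v₁ (Sinv ζ)) * Complex.I_sq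
end
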